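/- arXiv:2209.00966 — 2 statements merged into one kernel-verified Lean document; each statement's English description precedes it below -/
import Mathlib

section
/- (Path lifting for quotients by finite group actions.) Let G be a finite group acting on a Hausdorff topological space X such that for each g ∈ G the map x ↦ g • x is continuous, and let q : X → X/G be the quotient map onto the orbit space. Then q has the path lifting property: for every continuous path γ : [0,1] → X/G and every point x₀ ∈ X with q(x₀) = γ(0), there exists a continuous path γ̃ : [0,1] → X with q ∘ γ̃ = γ and γ̃(0) = x₀. -/
open Set Filter Topology

/-- `f` is a continuous selection on `A` of the family of sets `E`. -/
def IsSectionOn {X : Type*} [TopologicalSpace X] (E : ℝ → Set X) (f : ℝ → X) (A : Set ℝ) : Prop :=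
  ContinuousOn f A ∧ ∀ t ∈ A, f t ∈ E t

/-- Every point of `E` over `[a, b]` lies on a continuous selection of `E` over `[a, b]`. -/
def HasSectionsOnIcc {X : Type*} [TopologicalSpace X] (E : ℝ → Set X) (a b : ℝ) : Prop :=
  ∀ r ∈ Icc a b, ∀ x ∈ E r, ∃ f, IsSectionOn E f (Icc a b) ∧ f r = x

section Sections

variable {X : Type*} [TopologicalSpace X] {E : ℝ → Set X}

theorem IsSectionOn.mono {f : ℝ → X} {A B : Set ℝ} (hf : IsSectionOn E f B) (h : A ⊆ B) :
    IsSectionOn E f A :=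
  ⟨hf.1.mono h, fun t ht => hf.2 t (h ht)⟩

theorem IsSectionOn.congr {f g : ℝ → X} {A : Set ℝ} (hf : IsSectionOn E f A) (h : EqOn g f A) :
    IsSectionOn E g A :=
  ⟨hf.1.congr h, fun t ht => by rw [h ht]; exact hf.2 t ht⟩

theorem IsSectionOn.glue {f g : ℝ → X} {a b c : ℝ} (hab : a ≤ b) (hbc : b ≤ c)
    (hf : IsSectionOn E f (Icc a b)) (hg : IsSectionOn E g (Icc b c)) (hfg : f b = g b) :
    ∃ h, IsSectionOn E h (Icc a c) ∧ EqOn h f (Icc a b) ∧ EqOn h g (Icc b c) := by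
  have e₁ : EqOn (fun t => if t ≤ b then f t else g t) f (Icc a b) :=
    fun t ht => if_pos ht.2
  have e₂ : EqOn (fun t => if t ≤ b then f t else g t) g (Icc b c) := by
    intro t ht
    rcases ht.1.eq_or_lt with rfl | h
    · simpa using hfg
    · exact if_neg h.not_ge
  refine ⟨_, ?_, e₁, e₂⟩
  rw [← Icc_union_Icc_eq_Icc hab hbc]
  refine ⟨(hf.congr e₁).1.union_of_isClosed (hg.congr e₂).1 isClosed_Icc isClosed_Icc, ?_⟩
  rintro t (ht | ht)
  · exact (hf.congr e₁).2 t ht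
  · exact (hg.congr e₂).2 t ht

theorem HasSectionsOnIcc.mono {a b a' b' : ℝ} (h : HasSectionsOnIcc E a b) (ha : a ≤ a')
    (hb : b' ≤ b) : HasSectionsOnIcc E a' b' := by
  intro r hr x hx
  obtain ⟨f, hf, hfr⟩ := h r (Icc_subset_Icc ha hb hr) x hx
  exact ⟨f, hf.mono (Icc_subset_Icc ha hb), hfr⟩

theorem HasSectionsOnIcc.trans {a b c : ℝ} (hab : a ≤ b) (hbc : b ≤ c)
    (h₁ : HasSectionsOnIcc E a b) (h₂ : HasSectionsOnIcc E b c) : HasSectionsOnIcc E a c := by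
  intro r hr x hx
  rcases le_total r b with h | h
  · obtain ⟨f, hf, hfr⟩ := h₁ r ⟨hr.1, h⟩ x hx
    obtain ⟨g, hg, hgb⟩ := h₂ b ⟨le_rfl, hbc⟩ (f b) (hf.2 b ⟨hab, le_rfl⟩)
    obtain ⟨k, hk, hkf, -⟩ := hf.glue hab hbc hg hgb.symm
    exact ⟨k, hk, (hkf ⟨hr.1, h⟩).trans hfr⟩
  · obtain ⟨g, hg, hgr⟩ := h₂ r ⟨h, hr.2⟩ x hx
    obtain ⟨f, hf, hfb⟩ := h₁ b ⟨hab, le_rfl⟩ (g b) (hg.2 b ⟨le_rfl, hbc⟩)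
    obtain ⟨k, hk, -, hkg⟩ := hf.glue hab hbc hg hfb
    exact ⟨k, hk, (hkg ⟨h, hr.2⟩).trans hgr⟩

theorem hasSectionsOnIcc_of_locally {I : Set ℝ} (hI : IsPreconnected I)
    (hloc : ∀ t ∈ I, ∃ ε > 0, HasSectionsOnIcc E (t - ε) (t + ε)) {a b : ℝ} (ha : a ∈ I)
    (hb : b ∈ I) : HasSectionsOnIcc E a b := by
  refine (hI.induction₂' (fun s t => HasSectionsOnIcc E s t ∧ HasSectionsOnIcc E t s)
    ?_ ?_ ha hb).1
  · intro t ht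
    obtain ⟨ε, hε, h⟩ := hloc t ht
    filter_upwards [nhdsWithin_le_nhds
      (Icc_mem_nhds (show t - ε < t by linarith) (show t < t + ε by linarith))] with s hs
    have h₁ : HasSectionsOnIcc E t s := h.mono (by linarith) hs.2
    have h₂ : HasSectionsOnIcc E s t := h.mono hs.1 (by linarith)
    exact ⟨⟨h₁, h₂⟩, h₂, h₁⟩
  · have key : ∀ s t u : ℝ, HasSectionsOnIcc E s t →
        HasSectionsOnIcc E t u → HasSectionsOnIcc E s u := by
      intro s t u hst htu
      rcases le_total t s with h | h
      · exact htu.mono h le_rfl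
      rcases le_total t u with h' | h'
      · exact hst.trans h h' htu
      · exact hst.mono le_rfl h'
    rintro s t u - - - ⟨hst, hts⟩ ⟨htu, hut⟩
    exact ⟨key s t u hst htu, key u t s hut hts⟩

theorem IsSectionOn.extend {f : ℝ → X} {a b a' b' : ℝ} (hf : IsSectionOn E f (Icc a b))
    (ha : a' ≤ a) (hab : a ≤ b) (hb : b ≤ b') (h₁ : HasSectionsOnIcc E a' a)
    (h₂ : HasSectionsOnIcc E b b') :
    ∃ g, IsSectionOn E g (Icc a' b') ∧ EqOn g f (Icc a b) := by
  obtain ⟨k, hk, hkb⟩ := h₂ b ⟨le_rfl, hb⟩ (f b) (hf.2 b ⟨hab, le_rfl⟩)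
  obtain ⟨l, hl, hla⟩ := h₁ a ⟨ha, le_rfl⟩ (f a) (hf.2 a ⟨le_rfl, hab⟩)
  obtain ⟨m, hm, hmf, -⟩ := hf.glue hab hb hk hkb.symm
  obtain ⟨n, hn, -, hnm⟩ := hl.glue ha (hab.trans hb) hm (hla.trans (hmf ⟨le_rfl, hab⟩).symm)
  exact ⟨n, hn, (hnm.mono (Icc_subset_Icc le_rfl hb)).trans hmf⟩

theorem exists_exhaustion_by_Icc {I : Set ℝ} (hIo : IsOpen I) (hI : IsPreconnected I) {t₀ : ℝ}
    (ht₀ : t₀ ∈ I) :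
    ∃ a b : ℕ → ℝ, Antitone a ∧ Monotone b ∧ (∀ n, a n ∈ I) ∧ (∀ n, b n ∈ I) ∧
      (∀ n, t₀ ∈ Icc (a n) (b n)) ∧ ∀ t ∈ I, ∃ n, t ∈ Ioo (a n) (b n) := by
  have : OrdConnected I := hI.ordConnected
  have : Nonempty I := ⟨⟨t₀, ht₀⟩⟩
  obtain ⟨u, hu, hut⟩ := exists_seq_monotone_tendsto_atTop_atTop I
  obtain ⟨v, hv, hvt⟩ := exists_seq_antitone_tendsto_atTop_atBot I
  refine ⟨fun n => (min (v n) ⟨t₀, ht₀⟩ : I), fun n => (max (u n) ⟨t₀, ht₀⟩ : I), ?_, ?_,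
    fun n => Subtype.prop _, fun n => Subtype.prop _, fun n => ⟨?_, ?_⟩, ?_⟩
  · intro m n h
    exact Subtype.coe_le_coe.2 (min_le_min_right _ (hv h))
  · intro m n h
    exact Subtype.coe_le_coe.2 (max_le_max_right _ (hu h))
  · exact Subtype.coe_le_coe.2 (min_le_right (v n) ⟨t₀, ht₀⟩)
  · exact Subtype.coe_le_coe.2 (le_max_right (u n) ⟨t₀, ht₀⟩)
  · intro t ht
    obtain ⟨ε, hε, hball⟩ := Metric.isOpen_iff.1 hIo t ht
    have h₁ : t - ε / 2 ∈ I := hball (by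
      rw [Metric.mem_ball, Real.dist_eq, abs_lt]; constructor <;> linarith)
    have h₂ : t + ε / 2 ∈ I := hball (by
      rw [Metric.mem_ball, Real.dist_eq, abs_lt]; constructor <;> linarith)
    obtain ⟨n, hn₁, hn₂⟩ := ((hvt.eventually_le_atBot ⟨_, h₁⟩).and
      (hut.eventually_ge_atTop ⟨_, h₂⟩)).exists
    have k₁ := Subtype.coe_le_coe.2 ((min_le_left (v n) ⟨t₀, ht₀⟩).trans hn₁)
    have k₂ := Subtype.coe_le_coe.2 (hn₂.trans (le_max_left (u n) ⟨t₀, ht₀⟩))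
    refine ⟨n, k₁.trans_lt ?_, lt_of_lt_of_le ?_ k₂⟩
    · change t - ε / 2 < t
      linarith
    · change t < t + ε / 2
      linarith

theorem exists_isSectionOn_of_locally {I : Set ℝ} (hIo : IsOpen I) (hI : IsPreconnected I)
    (hloc : ∀ t ∈ I, ∃ ε > 0, HasSectionsOnIcc E (t - ε) (t + ε)) {t₀ : ℝ} (ht₀ : t₀ ∈ I)
    {x₀ : X} (hx₀ : x₀ ∈ E t₀) : ∃ f, IsSectionOn E f I ∧ f t₀ = x₀ := by
  obtain ⟨a, b, ha, hb, haI, hbI, hab, hex⟩ := exists_exhaustion_by_Icc hIo hI ht₀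
  have hsec : ∀ {s t : ℝ}, s ∈ I → t ∈ I → HasSectionsOnIcc E s t :=
    fun hs ht => hasSectionsOnIcc_of_locally hI hloc hs ht
  have hstep : ∀ n (f : {f // IsSectionOn E f (Icc (a n) (b n))}),
      ∃ g : {g // IsSectionOn E g (Icc (a (n + 1)) (b (n + 1)))},
        EqOn g.1 f.1 (Icc (a n) (b n)) := by
    rintro n ⟨f, hf⟩
    obtain ⟨g, hg, hgf⟩ := hf.extend (ha n.le_succ) ((hab n).1.trans (hab n).2) (hb n.le_succ)
      (hsec (haI _) (haI _)) (hsec (hbI _) (hbI _))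
    exact ⟨⟨g, hg⟩, hgf⟩
  choose next hnext using hstep
  obtain ⟨f₀, hf₀, hf₀x⟩ := hsec (haI 0) (hbI 0) t₀ (hab 0) x₀ hx₀
  let F : ∀ n, {f // IsSectionOn E f (Icc (a n) (b n))} := fun n => Nat.rec ⟨f₀, hf₀⟩ next n
  have hF : ∀ m n, m ≤ n → EqOn (F n).1 (F m).1 (Icc (a m) (b m)) := by
    intro m n hmn
    induction n, hmn using Nat.le_induction with
    | base => exact fun _ _ => rfl
    | succ n hmn ih =>
      exact ((hnext n (F n)).mono (Icc_subset_Icc (ha hmn) (hb hmn))).trans ih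
  have hF' : ∀ m n t, t ∈ Icc (a m) (b m) → t ∈ Icc (a n) (b n) → (F m).1 t = (F n).1 t := by
    intro m n t hm hn
    rcases le_total m n with h | h
    · exact (hF m n h hm).symm
    · exact hF n m h hn
  choose! N hN using hex
  have hfF : ∀ n, ∀ t ∈ I, t ∈ Icc (a n) (b n) → (F (N t)).1 t = (F n).1 t :=
    fun n t ht htn => hF' _ _ _ (Ioo_subset_Icc_self (hN t ht)) htn
  refine ⟨fun t => (F (N t)).1 t, ⟨fun t ht => ?_, fun t ht => ?_⟩, ?_⟩
  · have hnhds : Icc (a (N t)) (b (N t)) ∈ 𝓝 t := Icc_mem_nhds (hN t ht).1 (hN t ht).2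
    refine ContinuousAt.continuousWithinAt ?_
    refine ((F (N t)).2.1.continuousAt hnhds).congr ?_
    filter_upwards [hnhds, hIo.mem_nhds ht] with s hs hsI
    exact (hfF (N t) s hsI hs).symm
  · exact (F (N t)).2.2 t (Ioo_subset_Icc_self (hN t ht))
  · exact (hfF 0 t₀ ht₀ (hab 0)).trans hf₀x

/-- A family that locally has sections over an open set `D`, and whose selections are all
continuous at the points outside `D`, has a global continuous selection through any point. -/
theorem exists_continuous_section {D : Set ℝ} (hD : IsOpen D) (hne : ∀ t, (E t).Nonempty)
    (hloc : ∀ t ∈ D, ∃ ε > 0, HasSectionsOnIcc E (t - ε) (t + ε))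
    (hcont : ∀ f : ℝ → X, (∀ t, f t ∈ E t) → ∀ t ∉ D, ContinuousAt f t)
    {t₀ : ℝ} {x₀ : X} (hx₀ : x₀ ∈ E t₀) :
    ∃ f : ℝ → X, Continuous f ∧ (∀ t, f t ∈ E t) ∧ f t₀ = x₀ := by
  classical
  let C : ℝ → Set ℝ := connectedComponentIn D
  have hC : ∀ I : Set ℝ, ∃ f, ∀ t ∈ D, I = C t → IsSectionOn E f I ∧ (t₀ ∈ I → f t₀ = x₀) := by
    intro I
    by_cases h : ∃ t ∈ D, I = C t
    · obtain ⟨t, ht, rfl⟩ := h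
      have hloc' : ∀ s ∈ C t, ∃ ε > 0, HasSectionsOnIcc E (s - ε) (s + ε) :=
        fun s hs => hloc s (connectedComponentIn_subset D t hs)
      by_cases h₀ : t₀ ∈ C t
      · obtain ⟨f, hf, hfx⟩ := exists_isSectionOn_of_locally hD.connectedComponentIn
          isPreconnected_connectedComponentIn hloc' h₀ hx₀
        exact ⟨f, fun _ _ _ => ⟨hf, fun _ => hfx⟩⟩
      · obtain ⟨x, hx⟩ := hne t
        obtain ⟨f, hf, -⟩ := exists_isSectionOn_of_locally hD.connectedComponentIn
          isPreconnected_connectedComponentIn hloc' (mem_connectedComponentIn ht) hx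
        exact ⟨f, fun _ _ _ => ⟨hf, fun h => absurd h h₀⟩⟩
    · obtain ⟨x, -⟩ := hne 0
      exact ⟨fun _ => x, fun t ht hI => absurd ⟨t, ht, hI⟩ h⟩
  choose F hF using hC
  choose y hy using hne
  let f : ℝ → X := fun t => if t ∈ D then F (C t) t else if t = t₀ then x₀ else y t
  have hfD : ∀ t ∈ D, f t = F (C t) t := fun t ht => if_pos ht
  have hfE : ∀ t, f t ∈ E t := by
    intro t
    by_cases ht : t ∈ D
    · rw [hfD t ht]
      exact (hF _ t ht rfl).1.2 t (mem_connectedComponentIn ht)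
    · by_cases h : t = t₀
      · subst h
        simpa [f, ht] using hx₀
      · simpa [f, ht, h] using hy t
  refine ⟨f, continuous_iff_continuousAt.2 fun t => ?_, hfE, ?_⟩
  · by_cases ht : t ∈ D
    · have hnhds : C t ∈ 𝓝 t :=
        hD.connectedComponentIn.mem_nhds (mem_connectedComponentIn ht)
      refine ((hF _ t ht rfl).1.1.continuousAt hnhds).congr ?_
      filter_upwards [hnhds] with s hs
      rw [hfD s (connectedComponentIn_subset D t hs)]
      exact congrArg (fun I => F I s) (connectedComponentIn_eq hs)
    · exact hcont f hfE t ht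
  · by_cases ht : t₀ ∈ D
    · rw [hfD t₀ ht]
      exact (hF _ t₀ ht rfl).2 (mem_connectedComponentIn ht)
    · simp [f, ht]

end Sections

/-- A point of an `H`-invariant open set has a slice: an open neighbourhood, invariant under the
stabilizer `K` of the point in `H`, on which `H`-equivalence is `K`-equivalence. -/
theorem exists_open_slice {G X : Type*} [Group G] [Finite G] [TopologicalSpace X] [T2Space X]
    [MulAction G X] (hcont : ∀ g : G, Continuous fun x : X => g • x) (H : Subgroup G)
    {U : Set X} (hU : IsOpen U) {x : X} (hx : x ∈ U) :
    ∃ W ⊆ U, IsOpen W ∧ x ∈ W ∧ (∀ k ∈ H ⊓ MulAction.stabilizer G x, ∀ y ∈ W, k • y ∈ W) ∧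
      ∀ h ∈ H, ∀ y ∈ W, h • y ∈ W → h ∈ H ⊓ MulAction.stabilizer G x := by
  have hsep : ∀ g : G, ∃ A : Set X, IsOpen A ∧ x ∈ A ∧ (g • x ≠ x → ∀ y ∈ A, g • y ∉ A) := by
    intro g
    by_cases hg : g • x = x
    · exact ⟨univ, isOpen_univ, mem_univ _, fun h => absurd hg h⟩
    · obtain ⟨P, Q, hP, hQ, hxP, hxQ, hPQ⟩ := t2_separation hg
      refine ⟨Q ∩ (fun y => g • y) ⁻¹' P, hQ.inter (hP.preimage (hcont g)), ⟨hxQ, hxP⟩, ?_⟩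
      rintro - y ⟨-, hy⟩ ⟨hy', -⟩
      exact disjoint_left.1 hPQ hy hy'
  choose A hAo hxA hA using hsep
  let V : Set X := U ∩ ⋂ g, A g
  have hV : IsOpen V := hU.inter (isOpen_iInter_of_finite hAo)
  let K := H ⊓ MulAction.stabilizer G x
  let W : Set X := ⋂ k : K, (fun y => (k : G) • y) ⁻¹' V
  have hWV : W ⊆ V := fun y hy => by simpa using mem_iInter.1 hy 1
  refine ⟨W, hWV.trans inter_subset_left, isOpen_iInter_of_finite fun k => hV.preimage (hcont k),
    ?_, ?_, ?_⟩
  · refine mem_iInter.2 fun k => ?_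
    have hk : (k : G) • x = x := k.2.2
    change (k : G) • x ∈ V
    rw [hk]
    exact ⟨hx, mem_iInter.2 hxA⟩
  · intro k hk y hy
    refine mem_iInter.2 fun l => ?_
    have := mem_iInter.1 hy (l * ⟨k, hk⟩)
    simpa [mul_smul] using this
  · intro h hh y hy hhy
    refine ⟨hh, ?_⟩
    by_contra hne
    exact hA h hne y (mem_iInter.1 (hWV hy).2 h) (mem_iInter.1 (hWV hhy).2 h)

/-- Path lifting over an `H`-invariant open set on which the fibres of the open invariant map `q`
are `H`-orbits. -/
theorem exists_lift_of_fibers_eq_orbits {G X B : Type*} [Group G] [Finite G] [TopologicalSpace X]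
    [T2Space X] [TopologicalSpace B] [MulAction G X]
    (hcont : ∀ g : G, Continuous fun x : X => g • x) {q : X → B} (hqo : IsOpenMap q)
    (hqG : ∀ (g : G) x, q (g • x) = q x) (H : Subgroup G) (U : Set X) (hU : IsOpen U)
    (hHU : ∀ h ∈ H, ∀ x ∈ U, h • x ∈ U)
    (hqU : ∀ x ∈ U, ∀ y ∈ U, q x = q y → ∃ h ∈ H, h • x = y) {γ : ℝ → B} (hγ : Continuous γ)
    (hγU : ∀ t, γ t ∈ q '' U) {t₀ : ℝ} {x₀ : X} (hx₀ : x₀ ∈ U ∧ q x₀ = γ t₀) :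
    ∃ f : ℝ → X, Continuous f ∧ (∀ t, f t ∈ U ∧ q (f t) = γ t) ∧ f t₀ = x₀ := by
  induction H using WellFoundedLT.induction generalizing U γ t₀ x₀ with
  | ind H ih =>
  let M : Set X := U ∩ ⋃ h : H, {x | (h : G) • x ≠ x}
  have hM : IsOpen M := hU.inter (isOpen_iUnion fun h =>
    isOpen_ne_fun (hcont h) continuous_id)
  refine exists_continuous_section (E := fun t => {x | x ∈ U ∧ q x = γ t}) (D := γ ⁻¹' (q '' M))
    ((hqo M hM).preimage hγ) hγU ?_ ?_ hx₀
  · rintro t ⟨x, ⟨hxU, hxM⟩, hxt⟩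
    obtain ⟨⟨g, hgH⟩, hgx⟩ := mem_iUnion.1 hxM
    obtain ⟨W, hWU, hW, hxW, hKW, hHW⟩ := exists_open_slice hcont H hU hxU
    set K := H ⊓ MulAction.stabilizer G x
    have hKH : K < H := by
      refine lt_of_le_of_ne inf_le_left fun h => hgx ?_
      have : g ∈ K := h ▸ hgH
      exact this.2
    have hnhds : γ ⁻¹' (q '' W) ∈ 𝓝 t :=
      ((hqo W hW).preimage hγ).mem_nhds ⟨x, hxW, hxt⟩
    obtain ⟨ε, hε, hball⟩ := Metric.nhds_basis_closedBall.mem_iff.1 hnhds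
    rw [Real.closedBall_eq_Icc] at hball
    refine ⟨ε, hε, ?_⟩
    rintro r hr y ⟨hyU, hyr⟩
    obtain ⟨w, hwW, hwr⟩ := hball hr
    obtain ⟨h, hh, hhw⟩ := hqU w (hWU hwW) y hyU (hwr.trans hyr.symm)
    have hle : t - ε ≤ t + ε := by linarith
    obtain ⟨f, hf, hfW, hfr⟩ := ih K hKH W hW hKW
      (fun a ha b hb hab => by
        obtain ⟨k, hk, hkab⟩ := hqU a (hWU ha) b (hWU hb) hab
        exact ⟨k, hHW k hk a ha (hkab ▸ hb), hkab⟩)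
      (γ := fun s => γ (projIcc _ _ hle s))
      (hγ.comp (continuous_subtype_val.comp continuous_projIcc))
      (fun s => hball (projIcc _ _ hle s).2) (t₀ := r) (x₀ := w)
      ⟨hwW, by rw [hwr, projIcc_of_mem hle hr]⟩
    refine ⟨fun s => h • f s, ⟨((hcont h).comp hf).continuousOn, fun s hs => ⟨?_, ?_⟩⟩, ?_⟩
    · exact hHU h hh _ (hWU (hfW s).1)
    · rw [hqG, (hfW s).2, projIcc_of_mem hle hs]
    · simp only [hfr, hhw]
  · intro f hf t ht
    have hfix : ∀ h ∈ H, h • f t = f t := by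
      intro h hh
      by_contra hne
      exact ht ⟨f t, ⟨(hf t).1, mem_iUnion.2 ⟨⟨h, hh⟩, hne⟩⟩, (hf t).2⟩
    intro V hV
    obtain ⟨V', hV'V, hV', hfV'⟩ := mem_nhds_iff.1 hV
    let N : Set X := U ∩ ⋂ h : H, (fun y => (h : G) • y) ⁻¹' V'
    have hN : IsOpen N := hU.inter (isOpen_iInter_of_finite fun h => hV'.preimage (hcont h))
    have hfN : f t ∈ N := ⟨(hf t).1, mem_iInter.2 fun h => by
      change (h : G) • f t ∈ V'
      rwa [hfix h h.2]⟩
    change f ⁻¹' V ∈ 𝓝 t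
    filter_upwards [((hqo N hN).preimage hγ).mem_nhds ⟨f t, hfN, (hf t).2⟩] with s hs
    obtain ⟨y, ⟨hyU, hyN⟩, hys⟩ := hs
    obtain ⟨h, hh, hhy⟩ := hqU y hyU (f s) (hf s).1 (hys.trans (hf s).2.symm)
    apply hV'V
    rw [← hhy]
    exact mem_iInter.1 hyN ⟨h, hh⟩

/-- Path lifting property for the quotient map of a finite group action on a Hausdorff space. -/
theorem stmt_11 {G : Type*} [Group G] [Finite G] {X : Type*} [TopologicalSpace X] [T2Space X]
    [MulAction G X] (hcont : ∀ g : G, Continuous fun x : X => g • x)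
    (γ : unitInterval → Quotient (MulAction.orbitRel G X)) (hγ : Continuous γ)
    (x₀ : X) (h₀ : Quotient.mk (MulAction.orbitRel G X) x₀ = γ 0) :
    ∃ γ' : unitInterval → X, Continuous γ' ∧
      (∀ t, Quotient.mk (MulAction.orbitRel G X) (γ' t) = γ t) ∧ γ' 0 = x₀ := by
  have : ContinuousConstSMul G X := ⟨hcont⟩
  have hqo : IsOpenMap (Quotient.mk (MulAction.orbitRel G X)) :=
    isOpenMap_quotient_mk'_mul
  obtain ⟨f, hf, hfγ, hf₀⟩ := exists_lift_of_fibers_eq_orbits hcont hqo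
    (fun g x => Quotient.sound (MulAction.mem_orbit x g)) ⊤ univ isOpen_univ
    (fun _ _ _ _ => mem_univ _)
    (fun x _ y _ hxy => by
      obtain ⟨g, hg⟩ := Quotient.exact hxy.symm
      exact ⟨g, Subgroup.mem_top g, hg⟩)
    (γ := fun t => γ (projIcc 0 1 zero_le_one t)) (hγ.comp continuous_projIcc)
    (fun t => by
      obtain ⟨x, hx⟩ := Quotient.exists_rep (γ (projIcc 0 1 zero_le_one t))
      exact ⟨x, mem_univ _, hx⟩)
    (t₀ := 0) (x₀ := x₀) ⟨mem_univ _, by rw [h₀, projIcc_left]; rfl⟩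
  refine ⟨fun t => f t, hf.comp continuous_subtype_val, fun t => ?_, hf₀⟩
  rw [(hfγ t).2, projIcc_val]
end

section
/- (The dihedral action on 𝒫_n has order exactly 4n.) For every natural number n ≥ 1: σ^[4n](P) = P for every monic P ∈ ℂ[X] of natDegree n, and for every integer k with 0 < k < 4n there exists a monic polynomial P ∈ ℂ[X] of natDegree n with σ^[k](P) ≠ P. Consequently the permutation of 𝒫_n induced by σ has order exactly 4n. -/
open Polynomial

/-- The rotation `ω = exp(-π·I/(2n))`. -/
noncomputable def ω (n : ℕ) : ℂ := Complex.exp (-((Real.pi : ℂ) * Complex.I) / (2 * (n : ℂ)))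

/-- The map `σ(P)(z) = I · P(ω·z)`. -/
noncomputable def σ (n : ℕ) (P : ℂ[X]) : ℂ[X] :=
  C Complex.I * P.comp (C (ω n) * X)

theorem isPrimitiveRoot_ω {n : ℕ} (hn : n ≠ 0) : IsPrimitiveRoot (ω n) (4 * n) := by
  have hn' : (n : ℂ) ≠ 0 := Nat.cast_ne_zero.mpr hn
  have h : -((Real.pi : ℂ) * Complex.I) / (2 * (n : ℂ)) =
      -(2 * Real.pi * Complex.I / (4 * n : ℕ)) := by
    push_cast
    field_simp
    norm_num
  rw [ω, h, Complex.exp_neg]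
  exact (Complex.isPrimitiveRoot_exp (4 * n) (by positivity)).inv

theorem I_mul_ω_pow {n : ℕ} (hn : n ≠ 0) : Complex.I * ω n ^ n = 1 := by
  have hn' : (n : ℂ) ≠ 0 := Nat.cast_ne_zero.mpr hn
  have h : (n : ℂ) * (-((Real.pi : ℂ) * Complex.I) / (2 * (n : ℂ))) =
      -(Real.pi / 2 * Complex.I) := by
    field_simp
  rw [ω, ← Complex.exp_nat_mul, h, Complex.exp_neg, Complex.exp_pi_div_two_mul_I,
    mul_inv_cancel₀ Complex.I_ne_zero]

theorem coeff_iterate_σ (n k j : ℕ) (P : ℂ[X]) :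
    ((σ n)^[k] P).coeff j = (Complex.I * ω n ^ j) ^ k * P.coeff j := by
  induction k with
  | zero => simp
  | succ k ih =>
    rw [Function.iterate_succ_apply', σ, coeff_C_mul, comp_C_mul_X_coeff, ih]
    ring

/-- The permutation of `𝒫_n` induced by `σ` has order exactly `4n`: `σ^[4n]` is the identity
on monic polynomials of `natDegree n`, while for every `0 < k < 4n` some monic polynomial of
`natDegree n` is moved by `σ^[k]`. -/
theorem stmt_14 (n : ℕ) (hn : 1 ≤ n) :
    (∀ P : ℂ[X], P.Monic → P.natDegree = n → (σ n)^[4 * n] P = P) ∧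
    (∀ k : ℕ, 0 < k → k < 4 * n →
      ∃ P : ℂ[X], P.Monic ∧ P.natDegree = n ∧ (σ n)^[k] P ≠ P) := by
  have hn0 : n ≠ 0 := Nat.one_le_iff_ne_zero.mp hn
  have hω := isPrimitiveRoot_ω hn0
  refine ⟨fun P _ _ => ?_, fun k hk hk4 => ?_⟩
  · ext j
    rw [coeff_iterate_σ, mul_pow, pow_mul, Complex.I_pow_four, one_pow, pow_right_comm,
      hω.pow_eq_one, one_pow, one_mul, one_mul]
  · have hlt : (X ^ (n - 1) : ℂ[X]).degree < n := by
      rw [degree_X_pow]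
      exact_mod_cast Nat.sub_one_lt hn0
    refine ⟨X ^ n + X ^ (n - 1), monic_X_pow_add hlt, ?_, fun h => ?_⟩
    · rw [natDegree_add_eq_left_of_degree_lt (by rwa [degree_X_pow n]), natDegree_X_pow]
    · have hc := congrArg (fun P => P.coeff (n - 1)) h
      have hne : n - 1 ≠ n := (Nat.sub_one_lt hn0).ne
      simp only [coeff_iterate_σ, coeff_add, coeff_X_pow, if_neg hne, if_true, zero_add,
        mul_one] at hc
      refine hω.pow_ne_one_of_pos_of_lt hk.ne' hk4 ?_
      calc ω n ^ k = (Complex.I * ω n ^ (n - 1)) ^ k * ω n ^ k := by rw [hc, one_mul]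
        _ = (Complex.I * ω n ^ n) ^ k := by
          rw [← mul_pow, mul_assoc, pow_sub_one_mul hn0]
        _ = 1 := by rw [I_mul_ω_pow hn0, one_pow]
end
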